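/- Let (R, m, k) be a commutative noetherian local ring with E(k) the injective envelope of k, and let M be an R-module. Suppose n is an integer with Tor_n^R(k, M) = 0 and n ≥ sup{ i : H^i_m(Hom_R(M, E(k))) ≠ 0 }. Then Tor_i^R(k, M) = 0 for all i ≥ n, and moreover sup{ i : Tor_i^R(k, M) ≠ 0 } = depth R − depth_R M. -/

import Mathlib

open CategoryTheory Opposite

noncomputable section

/-- The `n`-th Ext group of `R`-modules `X` and `M`, i.e. `Ext^n_R(X, M)`. -/
def extModule (R : Type) [CommRing R] (n : ℕ) (X M : ModuleCat R) : ModuleCat R :=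
  ((Ext R (ModuleCat R) n).obj (op X)).obj M

/-- The `n`-th Tor group of `R`-modules `X` and `M`, i.e. `Tor_n^R(X, M)`. -/
def torModule (R : Type) [CommRing R] (n : ℕ) (X M : ModuleCat R) : ModuleCat R :=
  ((Tor (ModuleCat R) n).obj X).obj M

/-- The residue field `k(p) = R_p / p R_p` at a prime ideal `p`. -/
abbrev resField (R : Type) [CommRing R] (p : Ideal R) [p.IsPrime] : Type :=
  IsLocalRing.ResidueField (Localization.AtPrime p)

/-- `depth_R M := inf{ i : Ext^i_R(k, M) ≠ 0 }`, as an extended real (`⊤ = ∞` if all vanish). -/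
noncomputable def edepth (R : Type) [CommRing R] (k M : ModuleCat R) : EReal :=
  sInf {x : EReal | ∃ i : ℕ, x = (i : EReal) ∧ Nontrivial (extModule R i k M)}

/-- `width_R M := inf{ i : Tor_i^R(k, M) ≠ 0 }`, as an extended real (`⊤ = ∞` if all vanish). -/
noncomputable def ewidth (R : Type) [CommRing R] (k M : ModuleCat R) : EReal :=
  sInf {x : EReal | ∃ i : ℕ, x = (i : EReal) ∧ Nontrivial (torModule R i k M)}

/-- `sup{ i : Ext^i_R(k, M) ≠ 0 }`, as an extended real (`⊥ = -∞` if all vanish). -/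
noncomputable def extSup (R : Type) [CommRing R] (k M : ModuleCat R) : EReal :=
  sSup {x : EReal | ∃ i : ℕ, x = (i : EReal) ∧ Nontrivial (extModule R i k M)}

/-- `sup{ i : Tor_i^R(k, M) ≠ 0 }`, as an extended real (`⊥ = -∞` if all vanish). -/
noncomputable def torSup (R : Type) [CommRing R] (k M : ModuleCat R) : EReal :=
  sSup {x : EReal | ∃ i : ℕ, x = (i : EReal) ∧ Nontrivial (torModule R i k M)}

open CategoryTheory.Limits CategoryTheory.MonoidalCategory

section ExtComparison

variable {R : Type} [CommRing R]

/-- A morphism of short complexes of modules is a monomorphism on homology as soon as cycles that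
become boundaries are boundaries. -/
lemma mono_homologyMap_of_boundary {S₁ S₂ : ShortComplex (ModuleCat.{0} R)} (φ : S₁ ⟶ S₂)
    (h : ∀ x : S₁.X₂, S₁.g x = 0 → (∃ y : S₂.X₁, S₂.f y = φ.τ₂ x) → ∃ y : S₁.X₁, S₁.f y = x) :
    Mono (ShortComplex.homologyMap φ) := by
  rw [ModuleCat.mono_iff_injective, injective_iff_map_eq_zero]
  intro a ha
  obtain ⟨z, rfl⟩ := (ModuleCat.epi_iff_surjective S₁.homologyπ).1 inferInstance a
  rw [← ConcreteCategory.comp_apply, ShortComplex.homologyπ_naturality,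
    ConcreteCategory.comp_apply] at ha
  have hex := (ShortComplex.moduleCat_exact_iff
    (ShortComplex.mk S₂.toCycles S₂.homologyπ (by simp))).1
    (ShortComplex.exact_of_g_is_cokernel _ S₂.homologyIsCokernel) _ ha
  obtain ⟨y, hy⟩ := hex
  obtain ⟨y', hy'⟩ := h (S₁.iCycles z)
    (by rw [← ConcreteCategory.comp_apply, ShortComplex.iCycles_g]; rfl)
    ⟨y, by
      have := congr(S₂.iCycles $hy)
      dsimp at this
      rw [← ConcreteCategory.comp_apply, ShortComplex.toCycles_i, ← ConcreteCategory.comp_apply,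
        ShortComplex.cyclesMap_i] at this
      exact this⟩
  have hz : S₁.toCycles y' = z := by
    apply (ModuleCat.mono_iff_injective S₁.iCycles).1 inferInstance
    rw [← ConcreteCategory.comp_apply, ShortComplex.toCycles_i, hy']
  rw [← hz, ← ConcreteCategory.comp_apply, ShortComplex.toCycles_comp_homologyπ]
  rfl

/-- The opposite of a morphism of short complexes that is mono on homology is epi on homology. -/
lemma epi_homologyMap_opMap {C : Type*} [Category C] [Abelian C]
    {S₁ S₂ : ShortComplex C} (φ : S₁ ⟶ S₂) [Mono (ShortComplex.homologyMap φ)] :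
    Epi (ShortComplex.homologyMap (ShortComplex.opMap φ)) := by
  have h2 : ShortComplex.homologyMap (ShortComplex.opMap φ) = S₂.homologyOpIso.hom ≫
      (ShortComplex.homologyMap φ).op ≫ S₁.homologyOpIso.inv := by
    rw [ShortComplex.homologyMap_op]
    simp
  rw [h2]
  infer_instance

lemma subsingleton_extModule_succ_iff (n : ℕ) (X Y : ModuleCat.{0} R) :
    Subsingleton (extModule R (n + 1) X Y) ↔ Subsingleton (Abelian.Ext X Y (n + 1)) := by
  let P := projectiveResolution X
  have e : extModule R (n + 1) X Y ≅ (P.complex.linearYonedaObj R Y).homology (n + 1) :=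
    P.isoExt (n + 1) Y
  rw [← ModuleCat.isZero_iff_subsingleton, e.isZero_iff,
    ← HomologicalComplex.exactAt_iff_isZero_homology,
    HomologicalComplex.exactAt_iff' _ n (n + 1) (n + 2) (by simp) (by simp),
    ShortComplex.moduleCat_exact_iff]
  constructor
  · intro h
    refine subsingleton_of_forall_eq 0 fun α => ?_
    obtain ⟨f, hf, rfl⟩ := P.extMk_surjective α (n + 2) rfl
    rw [P.extMk_eq_zero_iff f _ _ hf n rfl]
    exact h f hf
  · intro h f hf
    exact (P.extMk_eq_zero_iff f (n + 2) rfl hf n rfl).1 (Subsingleton.elim _ _)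

lemma subsingleton_extModule_zero_iff (X Y : ModuleCat.{0} R) :
    Subsingleton (extModule R 0 X Y) ↔ Subsingleton (Abelian.Ext X Y 0) := by
  let P := projectiveResolution X
  have e : extModule R 0 X Y ≅ (P.complex.linearYonedaObj R Y).homology 0 := P.isoExt 0 Y
  rw [← ModuleCat.isZero_iff_subsingleton, e.isZero_iff,
    ← HomologicalComplex.exactAt_iff_isZero_homology,
    HomologicalComplex.exactAt_iff' _ 0 0 1 (by simp) (by simp),
    ShortComplex.moduleCat_exact_iff, Abelian.Ext.homEquiv₀.subsingleton_congr]
  have hd : (P.complex.linearYonedaObj R Y).d 0 0 = 0 :=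
    HomologicalComplex.shape _ _ _ (by simp)
  constructor
  · intro h
    refine subsingleton_of_forall_eq 0 fun α => ?_
    obtain ⟨y, hy⟩ := h (P.π.f 0 ≫ α)
      ((P.complex_d_comp_π_f_zero =≫ α).trans zero_comp)
    have h0 : P.π.f 0 ≫ α = 0 := by
      rw [← hy]
      exact congr($hd y)
    exact (cancel_epi (P.π.f 0)).1 (h0.trans comp_zero.symm)
  · intro h f hf
    obtain ⟨g, hg⟩ := CokernelCofork.IsColimit.desc' P.isColimitCokernelCofork f hf
    have : g = 0 := h.elim _ _
    refine ⟨0, ?_⟩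
    rw [map_zero]
    subst this
    rw [← hg]
    exact comp_zero.symm

/-- The two definitions of `Ext` vanish simultaneously. -/
lemma subsingleton_extModule_iff (n : ℕ) (X Y : ModuleCat.{0} R) :
    Subsingleton (extModule R n X Y) ↔ Subsingleton (Abelian.Ext X Y n) := by
  cases n with
  | zero => exact subsingleton_extModule_zero_iff X Y
  | succ n => exact subsingleton_extModule_succ_iff n X Y

/-- If precomposition with `f` is injective on the derived-category `Ext`, it is injective on the
`Ext` defined through projective resolutions. -/
lemma injective_ext_map_succ (n : ℕ) {X X' Y : ModuleCat.{0} R} (f : X ⟶ X')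
    (h : ∀ e : Abelian.Ext X' Y (n + 1),
      (Abelian.Ext.mk₀ f).comp e (zero_add _) = 0 → e = 0) :
    Function.Injective (((Ext R (ModuleCat.{0} R) (n + 1)).map f.op).app Y) := by
  rw [← ModuleCat.mono_iff_injective]
  let P := projectiveResolution X
  let P' := projectiveResolution X'
  let φ : P.complex ⟶ P'.complex := ProjectiveResolution.lift f P P'
  have hφ : φ.f 0 ≫ P'.π.f 0 = P.π.f 0 ≫ f := ProjectiveResolution.lift_commutes_zero f P P'
  let F := ((linearYoneda R (ModuleCat.{0} R)).obj Y).rightOp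
  change Mono ((F.leftDerived (n + 1)).map f).unop
  suffices Epi ((F.leftDerived (n + 1)).map f) by infer_instance
  have nat := ProjectiveResolution.isoLeftDerivedObj_hom_naturality f P P' φ hφ F (n + 1)
  have e1 : (F.leftDerived (n + 1)).map f = (P.isoLeftDerivedObj F (n + 1)).hom ≫
      (F.mapHomologicalComplex _ ⋙ HomologicalComplex.homologyFunctor _ _ (n + 1)).map φ ≫
      (P'.isoLeftDerivedObj F (n + 1)).inv := by
    rw [← Category.assoc, ← nat, Category.assoc, Iso.hom_inv_id, Category.comp_id]
  rw [e1]
  suffices Epi (ShortComplex.homologyMap ((HomologicalComplex.shortComplexFunctor _ _ (n + 1)).map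
      ((F.mapHomologicalComplex (ComplexShape.down ℕ)).map φ))) by
    have : Epi ((F.mapHomologicalComplex _ ⋙
      HomologicalComplex.homologyFunctor _ _ (n + 1)).map φ) := this
    infer_instance
  let ψ := ShortComplex.unopMap ((HomologicalComplex.shortComplexFunctor _ _ (n + 1)).map
      ((F.mapHomologicalComplex (ComplexShape.down ℕ)).map φ))
  suffices Mono (ShortComplex.homologyMap ψ) from epi_homologyMap_opMap ψ
  apply mono_homologyMap_of_boundary
  rintro x hx ⟨y, hy⟩
  have hpre (Q : ChainComplex (ModuleCat R) ℕ) (z : Q.X (n + 1) ⟶ Y) {m : ℕ}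
      (hm : (ComplexShape.down ℕ).prev (n + 1) = m) :
      Q.d m (n + 1) ≫ z = 0 ↔ Q.d ((ComplexShape.down ℕ).prev (n + 1)) (n + 1) ≫ z = 0 := by
    subst hm; rfl
  have hnext (Q : ChainComplex (ModuleCat R) ℕ) (z : Q.X (n + 1) ⟶ Y) {m : ℕ}
      (hm : (ComplexShape.down ℕ).next (n + 1) = m) :
      (∃ y, Q.d (n + 1) m ≫ y = z) ↔
        ∃ y, Q.d (n + 1) ((ComplexShape.down ℕ).next (n + 1)) ≫ y = z := by
    subst hm; rfl
  have hx' := (hpre P'.complex x (ChainComplex.prev ℕ (n + 1))).2 hx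
  have hy' := (hnext P.complex (φ.f (n + 1) ≫ x) (ChainComplex.next_nat_succ n)).2 ⟨y, hy⟩
  have key (z : P'.complex.X (n + 1) ⟶ Y) (hz : P'.complex.d (n + 2) (n + 1) ≫ z = 0)
      (hyz : ∃ y, P.complex.d (n + 1) n ≫ y = φ.f (n + 1) ≫ z) : P'.extMk z (n + 2) rfl hz = 0 := by
    apply h
    rw [ProjectiveResolution.mk₀_comp_extMk z _ rfl hz ⟨φ, hφ⟩,
      ProjectiveResolution.extMk_eq_zero_iff _ _ _ rfl _ n rfl]
    exact hyz
  exact (hnext P'.complex x (ChainComplex.next_nat_succ n)).1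
    ((P'.extMk_eq_zero_iff x _ rfl hx' n rfl).1 (key x hx' hy'))

end ExtComparison

section ExtVanishing

variable {R : Type} [CommRing R]

/-- Vanishing of `Ext^i_R(X, N)`, for unbundled modules. -/
def ExtVanishes (R : Type) [CommRing R] (X N : Type) [AddCommGroup X] [Module R X]
    [AddCommGroup N] [Module R N] (i : ℕ) : Prop :=
  Subsingleton (Abelian.Ext (ModuleCat.of R X) (ModuleCat.of R N) i)

namespace ExtVanishes

variable {A B C N : Type} [AddCommGroup A] [Module R A] [AddCommGroup B] [Module R B]
  [AddCommGroup C] [Module R C] [AddCommGroup N] [Module R N] {i : ℕ}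

lemma zero_iff : ExtVanishes R A N 0 ↔ Subsingleton (A →ₗ[R] N) := by
  unfold ExtVanishes
  rw [Abelian.Ext.homEquiv₀.subsingleton_congr, ModuleCat.homEquiv.subsingleton_congr]

lemma of_retract (a : A →ₗ[R] B) (b : B →ₗ[R] A) (h : b ∘ₗ a = LinearMap.id)
    (hB : ExtVanishes R B N i) : ExtVanishes R A N i := by
  refine subsingleton_of_forall_eq 0 fun e => ?_
  have h1 : ModuleCat.ofHom a ≫ ModuleCat.ofHom b = 𝟙 _ := by
    rw [← ModuleCat.ofHom_comp, h]; rfl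
  have h2 : (Abelian.Ext.mk₀ (ModuleCat.ofHom b)).comp e (zero_add _) = 0 := hB.elim _ _
  rw [← Abelian.Ext.mk₀_id_comp e, ← h1, ← Abelian.Ext.mk₀_comp_mk₀_assoc, h2,
    Abelian.Ext.comp_zero]

lemma congr (e : A ≃ₗ[R] B) : ExtVanishes R A N i ↔ ExtVanishes R B N i :=
  ⟨of_retract e.symm.toLinearMap e.toLinearMap (by ext; simp),
    of_retract e.toLinearMap e.symm.toLinearMap (by ext; simp)⟩

lemma of_projective [Module.Projective R A] : ExtVanishes R A N (i + 1) := by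
  have : Projective (ModuleCat.of R A) := (IsProjective.iff_projective A).1 inferInstance
  exact subsingleton_of_forall_eq 0 fun e => Abelian.Ext.eq_zero_of_projective e

lemma of_subsingleton [Subsingleton A] : ExtVanishes R A N i := by
  cases i with
  | zero => exact zero_iff.2 inferInstance
  | succ i => exact of_projective

section LES

variable {f : A →ₗ[R] B} {g : B →ₗ[R] C}

lemma shortExact (hf : Function.Injective f) (hg : Function.Surjective g)
    (h : Function.Exact f g) :
    (ShortComplex.mk (ModuleCat.ofHom f) (ModuleCat.ofHom g)
      (by rw [← ModuleCat.ofHom_comp, h.linearMap_comp_eq_zero]; rfl)).ShortExact :=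
  ModuleCat.shortComplex_shortExact _ h hf hg

variable (hf : Function.Injective f) (hg : Function.Surjective g) (h : Function.Exact f g)
include hf hg h

lemma middle (hA : ExtVanishes R A N i) (hC : ExtVanishes R C N i) : ExtVanishes R B N i := by
  refine subsingleton_of_forall_eq 0 fun e => ?_
  obtain ⟨x, rfl⟩ := Abelian.Ext.contravariant_sequence_exact₂ (shortExact hf hg h) _ e
    (hA.elim _ _)
  rw [hC.elim x 0, Abelian.Ext.comp_zero]

lemma right (hA : ExtVanishes R A N i) (hB : ExtVanishes R B N (i + 1)) :
    ExtVanishes R C N (i + 1) := by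
  refine subsingleton_of_forall_eq 0 fun e => ?_
  obtain ⟨x, rfl⟩ := Abelian.Ext.contravariant_sequence_exact₃ (shortExact hf hg h) _ e
    (hB.elim _ _) (add_comm 1 i)
  rw [hA.elim x 0, Abelian.Ext.comp_zero]

lemma left (hB : ExtVanishes R B N i) (hC : ExtVanishes R C N (i + 1)) :
    ExtVanishes R A N i := by
  refine subsingleton_of_forall_eq 0 fun e => ?_
  obtain ⟨x, rfl⟩ := Abelian.Ext.contravariant_sequence_exact₁ (shortExact hf hg h) _ e
    (add_comm 1 i) (hC.elim _ _)
  rw [hB.elim x 0, Abelian.Ext.comp_zero]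

lemma exists_extension (hC : ExtVanishes R C N 1) (φ : A →ₗ[R] N) :
    ∃ ψ : B →ₗ[R] N, ψ ∘ₗ f = φ := by
  obtain ⟨x, hx⟩ := Abelian.Ext.contravariant_sequence_exact₁ (shortExact hf hg h) _
    (Abelian.Ext.mk₀ (ModuleCat.ofHom φ)) (add_zero 1) (hC.elim _ _)
  obtain ⟨ψ, rfl⟩ := Abelian.Ext.homEquiv₀.symm.surjective x
  simp only [Abelian.Ext.homEquiv₀_symm_apply] at hx
  rw [Abelian.Ext.mk₀_comp_mk₀] at hx
  have := Abelian.Ext.homEquiv₀.symm.injective hx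
  exact ⟨ψ.hom, congr(ModuleCat.Hom.hom $this)⟩

lemma one_of_extension (hB : ExtVanishes R B N 1)
    (hext : ∀ φ : A →ₗ[R] N, ∃ ψ : B →ₗ[R] N, ψ ∘ₗ f = φ) : ExtVanishes R C N 1 := by
  refine subsingleton_of_forall_eq 0 fun e => ?_
  obtain ⟨x, rfl⟩ := Abelian.Ext.contravariant_sequence_exact₃ (shortExact hf hg h) _ e
    (hB.elim _ _) (add_zero 1)
  obtain ⟨φ, rfl⟩ := Abelian.Ext.homEquiv₀.symm.surjective x
  obtain ⟨ψ, hψ⟩ := hext φ.hom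
  have h1 : ModuleCat.ofHom f ≫ ModuleCat.ofHom ψ = φ := by
    rw [← ModuleCat.ofHom_comp, hψ]; rfl
  simp only [Abelian.Ext.homEquiv₀_symm_apply]
  rw [← h1, ← Abelian.Ext.mk₀_comp_mk₀, ← Abelian.Ext.comp_assoc_of_second_deg_zero]
  have := (shortExact hf hg h).extClass_comp
  simp only at this
  rw [this, Abelian.Ext.zero_comp]

/-- If `Ext^i` of the left end vanishes, restriction along the surjection is injective on
`Ext^{i+1}`. -/
lemma injective_comp (hA : ExtVanishes R A N i)
    (e : Abelian.Ext (ModuleCat.of R C) (ModuleCat.of R N) (i + 1))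
    (he : (Abelian.Ext.mk₀ (ModuleCat.ofHom g)).comp e (zero_add _) = 0) : e = 0 := by
  obtain ⟨x, rfl⟩ := Abelian.Ext.contravariant_sequence_exact₃ (shortExact hf hg h) _ e
    he (add_comm 1 i)
  rw [hA.elim x 0, Abelian.Ext.comp_zero]

end LES

lemma prod (hA : ExtVanishes R A N i) (hB : ExtVanishes R B N i) : ExtVanishes R (A × B) N i :=
  middle LinearMap.inl_injective LinearMap.snd_surjective Function.Exact.inl_snd hA hB

lemma pi (hA : ExtVanishes R A N i) (r : ℕ) : ExtVanishes R (Fin r → A) N i := by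
  induction r with
  | zero => exact of_subsingleton
  | succ r ih => exact (congr (Fin.consLinearEquiv R (fun _ : Fin (r + 1) => A))).1 (prod hA ih)

end ExtVanishes

section ResidueField

open IsLocalRing

variable [IsLocalRing R] {X N : Type} [AddCommGroup X] [Module R X] [AddCommGroup N] [Module R N]
  {i : ℕ}

/-- A finite module killed by the maximal ideal is a finite power of the residue field. -/
lemma exists_linearEquiv_pi_residueField [Module.Finite R X]
    (hX : ∀ r ∈ maximalIdeal R, ∀ x : X, r • x = 0) :
    ∃ r : ℕ, Nonempty (X ≃ₗ[R] (Fin r → ResidueField R)) := by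
  have ht : Module.IsTorsionBySet R X (maximalIdeal R : Set R) := fun x r => hX r r.2 x
  let _ : Module (ResidueField R) X := ht.module
  have : IsScalarTower R (ResidueField R) X := ht.isScalarTower
  have : Module.Finite (ResidueField R) X := Module.Finite.of_restrictScalars_finite R _ _
  exact ⟨_, ⟨(Module.finBasis (ResidueField R) X).equivFun.restrictScalars R⟩⟩

lemma ExtVanishes.of_residueField [Module.Finite R X]
    (hX : ∀ r ∈ maximalIdeal R, ∀ x : X, r • x = 0)
    (h : ExtVanishes R (ResidueField R) N i) : ExtVanishes R X N i := by
  obtain ⟨r, ⟨e⟩⟩ := exists_linearEquiv_pi_residueField hX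
  exact (congr e).2 (pi h r)

lemma ExtVanishes.residueField_of_nontrivial [Module.Finite R X] [Nontrivial X]
    (hX : ∀ r ∈ maximalIdeal R, ∀ x : X, r • x = 0)
    (h : ExtVanishes R X N i) : ExtVanishes R (ResidueField R) N i := by
  obtain ⟨r, ⟨e⟩⟩ := exists_linearEquiv_pi_residueField hX
  cases r with
  | zero => exact absurd e.toEquiv.subsingleton (not_subsingleton X)
  | succ r =>
    exact of_retract (LinearMap.single R (fun _ => ResidueField R) 0) (LinearMap.proj 0)
      (by ext; simp) ((congr e).1 h)

end ResidueField

end ExtVanishing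

section LocalCohomology

open IsLocalRing

variable {R : Type} [CommRing R]

/-- If `Ext` of every quotient `R ⧸ J` restricts injectively to the quotients by powers of `J`,
local cohomology contains it. -/
lemma subsingleton_of_localCohomology (J : Ideal R) (i : ℕ) (N : ModuleCat.{0} R)
    (hinj : ∀ t : ℕ, ∀ h : J ^ t ≤ J ^ 1, Function.Injective
      (((Ext R (ModuleCat.{0} R) i).map
        (ModuleCat.ofHom (Submodule.mapQ (J ^ t) (J ^ 1) LinearMap.id h)).op).app N))
    (hlc : Subsingleton ((localCohomology J i).obj N)) :
    Subsingleton (extModule R i (ModuleCat.of R (R ⧸ J ^ 1)) N) := by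
  let F : ℕᵒᵖᵒᵖ ⥤ ModuleCat.{0} R :=
    localCohomology.diagram (localCohomology.idealPowersDiagram J) i ⋙
      (evaluation (ModuleCat.{0} R) (ModuleCat.{0} R)).obj N
  have := localCohomology.hasColimitDiagram.{0, 0} (localCohomology.idealPowersDiagram J) i
  let D : Cocone F := ((evaluation (ModuleCat.{0} R) (ModuleCat.{0} R)).obj N).mapCocone
    (colimit.cocone (localCohomology.diagram (localCohomology.idealPowersDiagram J) i))
  have hD : IsColimit D := isColimitOfPreserves _ (colimit.isColimit _)
  have hD' : Subsingleton D.pt := hlc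
  refine subsingleton_of_forall_eq 0 fun x => ?_
  obtain ⟨j, f, g, hfg⟩ := Concrete.isColimit_exists_of_rep_eq (F := F) hD
    (i := op (op 1)) (j := op (op 1)) x (0 : extModule R i (ModuleCat.of R (R ⧸ J ^ 1)) N)
    (hD'.elim _ _)
  have hg : F.map g (0 : F.obj (op (op 1))) = 0 := map_zero _
  have hfg' : F.map f x = F.map f (0 : F.obj (op (op 1))) := by
    rw [map_zero]
    exact hfg.trans hg
  exact hinj j.unop.unop ((localCohomology.idealPowersDiagram J).map f.unop).down.down hfg'

lemma ExtVanishes.of_pow_smul_eq_zero [IsNoetherianRing R] [IsLocalRing R] {N : Type}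
    [AddCommGroup N] [Module R N] {i : ℕ} (h : ExtVanishes R (ResidueField R) N i) (s : ℕ)
    (X : Type) [AddCommGroup X] [Module R X] [Module.Finite R X]
    (hX : maximalIdeal R ^ s • (⊤ : Submodule R X) = ⊥) : ExtVanishes R X N i := by
  induction s generalizing X with
  | zero =>
    have : Subsingleton X := by
      rw [pow_zero, Ideal.one_eq_top, Submodule.top_smul] at hX
      exact (Submodule.subsingleton_iff R).1 (subsingleton_of_bot_eq_top hX.symm)
    exact of_subsingleton
  | succ s ih =>
    let Y : Submodule R X := maximalIdeal R • ⊤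
    refine middle Y.injective_subtype Y.mkQ_surjective (LinearMap.exact_subtype_mkQ Y)
      (ih Y ?_) (of_residueField ?_ h)
    · apply Submodule.map_injective_of_injective Y.injective_subtype
      rw [Submodule.map_smul'', Submodule.map_bot, Submodule.map_top, Submodule.range_subtype,
        ← hX, pow_succ, Submodule.mul_smul]
    · intro r hr x
      obtain ⟨x, rfl⟩ := Y.mkQ_surjective x
      rw [← map_smul, Submodule.mkQ_apply, Submodule.Quotient.mk_eq_zero]
      exact Submodule.smul_mem_smul hr trivial

/-- Rigidity: vanishing of a single `Ext` of the residue field propagates to the next degree when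
the next local cohomology module vanishes. -/
lemma ExtVanishes.succ_of_localCohomology [IsNoetherianRing R] [IsLocalRing R] {N : Type}
    [AddCommGroup N] [Module R N] {i : ℕ} (h : ExtVanishes R (ResidueField R) N i)
    (hlc : Subsingleton
      ((localCohomology (maximalIdeal R) (i + 1)).obj (ModuleCat.of R N))) :
    ExtVanishes R (ResidueField R) N (i + 1) := by
  have key := subsingleton_of_localCohomology (maximalIdeal R) (i + 1) (ModuleCat.of R N) ?_ hlc
  · rw [subsingleton_extModule_iff] at key
    exact (congr (Submodule.quotEquivOfEq _ _ (pow_one _))).1 key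
  · intro t ht
    apply injective_ext_map_succ
    let g : R ⧸ maximalIdeal R ^ t →ₗ[R] R ⧸ maximalIdeal R ^ 1 :=
      Submodule.mapQ _ _ LinearMap.id ht
    have hg : Function.Surjective g := fun x => by
      obtain ⟨x, rfl⟩ := Submodule.mkQ_surjective _ x
      exact ⟨Submodule.mkQ _ x, rfl⟩
    refine injective_comp (LinearMap.ker g).injective_subtype hg
      (LinearMap.exact_subtype_ker_map g) (h.of_pow_smul_eq_zero t _ ?_)
    rw [eq_bot_iff, Submodule.smul_le]
    rintro r hr ⟨x, hx⟩ -
    obtain ⟨x, rfl⟩ := Submodule.mkQ_surjective _ x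
    rw [Submodule.mem_bot]
    ext
    rw [Submodule.coe_smul, ← map_smul]
    exact (Submodule.Quotient.mk_eq_zero _).2 (Ideal.mul_mem_right _ _ hr)

end LocalCohomology

section Duality

variable {R : Type} [CommRing R]

section HomExact

variable {A B C T M : Type} [AddCommGroup A] [Module R A] [AddCommGroup B] [Module R B]
  [AddCommGroup C] [Module R C] [AddCommGroup T] [Module R T] [AddCommGroup M] [Module R M]

/-- Exactness at `Hom(B, T)` of the sequence obtained by applying `Hom(-, T)` to
`A → B → C`. -/
def HomExact (f : A →ₗ[R] B) (g : B →ₗ[R] C) (T : Type) [AddCommGroup T] [Module R T] : Prop :=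
  ∀ φ : B →ₗ[R] T, φ ∘ₗ f = 0 → ∃ ψ : C →ₗ[R] T, ψ ∘ₗ g = φ

lemma homExact_of_exact [Module.Injective R T] {f : A →ₗ[R] B} {g : B →ₗ[R] C}
    (h : Function.Exact f g) : HomExact f g T := by
  intro φ hφ
  obtain ⟨χ, hχ⟩ : ∃ χ : LinearMap.range g →ₗ[R] T, χ ∘ₗ g.rangeRestrict = φ := by
    have hle : LinearMap.ker g ≤ LinearMap.ker φ := by
      rw [h.linearMap_ker_eq, LinearMap.range_le_ker_iff, hφ]
    refine ⟨(LinearMap.ker g).liftQ φ hle ∘ₗ g.quotKerEquivRange.symm.toLinearMap, ?_⟩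
    ext b
    have : g.quotKerEquivRange.symm (g.rangeRestrict b) = (LinearMap.ker g).mkQ b := by
      rw [LinearEquiv.symm_apply_eq]; rfl
    simp only [LinearMap.comp_apply, LinearEquiv.coe_coe, this]
    rfl
  obtain ⟨ψ, hψ⟩ := Module.Injective.extension_property R T _ _
    (LinearMap.range g).subtype (LinearMap.range g).injective_subtype χ
  refine ⟨ψ, ?_⟩
  rw [← hχ, ← hψ]
  rfl

/-- A cogenerator detects exactness. -/
lemma exact_of_homExact
    (hT : ∀ (X : Type) [AddCommGroup X] [Module R X] (x : X), x ≠ 0 → ∃ φ : X →ₗ[R] T, φ x ≠ 0)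
    {f : A →ₗ[R] B} {g : B →ₗ[R] C} (hfg : g ∘ₗ f = 0) (h : HomExact f g T) :
    Function.Exact f g := by
  refine LinearMap.exact_iff.2 (le_antisymm (fun b hb => ?_) (LinearMap.range_le_ker_iff.2 hfg))
  by_contra hn
  obtain ⟨φ, hφ⟩ := hT _ ((LinearMap.range f).mkQ b)
    (by rwa [Submodule.mkQ_apply, ne_eq, Submodule.Quotient.mk_eq_zero])
  obtain ⟨ψ, hψ⟩ := h (φ ∘ₗ (LinearMap.range f).mkQ)
    (by rw [LinearMap.comp_assoc, LinearMap.range_mkQ_comp, LinearMap.comp_zero])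
  apply hφ
  rw [← LinearMap.comp_apply, ← hψ, LinearMap.comp_apply, LinearMap.mem_ker.1 hb, map_zero]

/-- Hom-tensor adjunction. -/
lemma homExact_hom_iff {f : A →ₗ[R] B} {g : B →ₗ[R] C} :
    HomExact f g (M →ₗ[R] T) ↔ HomExact (f.rTensor M) (g.rTensor M) T := by
  constructor
  · intro h φ hφ
    obtain ⟨ψ, hψ⟩ := h (TensorProduct.curry φ) (by
      ext a m
      exact congr($hφ (a ⊗ₜ m)))
    refine ⟨TensorProduct.lift ψ, TensorProduct.ext' fun b m => ?_⟩
    exact congr($hψ b m)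
  · intro h φ hφ
    obtain ⟨ψ, hψ⟩ := h (TensorProduct.lift φ) (TensorProduct.ext' fun a m =>
      congr($hφ a m))
    refine ⟨TensorProduct.curry ψ, ?_⟩
    ext b m
    exact congr($hψ (b ⊗ₜ m))

lemma injective_hom (P T : Type) [AddCommGroup P] [Module R P] [AddCommGroup T] [Module R T]
    [Module.Flat R P] [Module.Injective R T] : Module.Injective R (P →ₗ[R] T) := by
  refine ⟨fun X Y _ _ _ _ f hf g => ?_⟩
  obtain ⟨ψ, hψ⟩ := Module.Injective.extension_property R T _ _ (f.rTensor P)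
    (Module.Flat.rTensor_preserves_injective_linearMap f hf) (TensorProduct.lift g)
  refine ⟨TensorProduct.curry ψ, fun x => ?_⟩
  ext p
  exact congr($hψ (x ⊗ₜ p))

lemma exact_rTensor_iff_exact_lTensor {f : A →ₗ[R] B} {g : B →ₗ[R] C} :
    Function.Exact (f.rTensor M) (g.rTensor M) ↔ Function.Exact (f.lTensor M) (g.lTensor M) :=
  (Function.Exact.iff_of_ladder_linearEquiv (e₁ := TensorProduct.comm R M A)
    (e₂ := TensorProduct.comm R M B) (e₃ := TensorProduct.comm R M C)
    (by ext; rfl) (by ext; rfl))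

end HomExact

namespace ExtVanishes

variable {A B C X : Type} [AddCommGroup A] [Module R A] [AddCommGroup B] [Module R B]
  [AddCommGroup C] [Module R C] [AddCommGroup X] [Module R X] {i : ℕ}

lemma congr_right (e : A ≃ₗ[R] B) (h : ExtVanishes R X A i) : ExtVanishes R X B i := by
  refine subsingleton_of_forall_eq 0 fun x => ?_
  have h1 : ModuleCat.ofHom e.symm.toLinearMap ≫ ModuleCat.ofHom e.toLinearMap = 𝟙 _ := by
    rw [← ModuleCat.ofHom_comp]; simp
  have h2 : x.comp (Abelian.Ext.mk₀ (ModuleCat.ofHom e.symm.toLinearMap)) (add_zero _) = 0 :=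
    h.elim _ _
  rw [← Abelian.Ext.comp_mk₀_id x, ← h1, ← Abelian.Ext.mk₀_comp_mk₀,
    ← Abelian.Ext.comp_assoc_of_third_deg_zero, h2, Abelian.Ext.zero_comp]

variable {f : A →ₗ[R] B} {g : B →ₗ[R] C}
  (hf : Function.Injective f) (hg : Function.Surjective g) (h : Function.Exact f g)

include hf hg h

/-- Dimension shifting along an injective module in the second variable. -/
lemma succ_iff_of_injective [Module.Injective R B] :
    ExtVanishes R X A (i + 2) ↔ ExtVanishes R X C (i + 1) := by
  have : Injective (ModuleCat.of R B) := Module.injective_object_of_injective_module R B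
  constructor
  · refine fun hA => subsingleton_of_forall_eq 0 fun e => ?_
    obtain ⟨x, rfl⟩ := Abelian.Ext.covariant_sequence_exact₃ _ (shortExact hf hg h) e rfl
      (hA.elim _ _)
    rw [Abelian.Ext.eq_zero_of_injective x, Abelian.Ext.zero_comp]
  · refine fun hC => subsingleton_of_forall_eq 0 fun e => ?_
    obtain ⟨x, rfl⟩ := Abelian.Ext.covariant_sequence_exact₁ _ (shortExact hf hg h) e
      (Abelian.Ext.eq_zero_of_injective _) rfl
    rw [hC.elim x 0, Abelian.Ext.zero_comp]

lemma one_iff_of_injective [Module.Injective R B] :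
    ExtVanishes R X A 1 ↔ ∀ φ : X →ₗ[R] C, ∃ ψ : X →ₗ[R] B, g ∘ₗ ψ = φ := by
  have : Injective (ModuleCat.of R B) := Module.injective_object_of_injective_module R B
  constructor
  · intro hA φ
    obtain ⟨x, hx⟩ := Abelian.Ext.covariant_sequence_exact₃ _ (shortExact hf hg h)
      (Abelian.Ext.mk₀ (ModuleCat.ofHom φ)) (zero_add 1) (hA.elim _ _)
    obtain ⟨ψ, rfl⟩ := Abelian.Ext.homEquiv₀.symm.surjective x
    simp only [Abelian.Ext.homEquiv₀_symm_apply] at hx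
    rw [Abelian.Ext.mk₀_comp_mk₀] at hx
    have := Abelian.Ext.homEquiv₀.symm.injective hx
    exact ⟨ψ.hom, congr(ModuleCat.Hom.hom $this)⟩
  · refine fun hlift => subsingleton_of_forall_eq 0 fun e => ?_
    obtain ⟨x, rfl⟩ := Abelian.Ext.covariant_sequence_exact₁ _ (shortExact hf hg h) e
      (Abelian.Ext.eq_zero_of_injective _) (zero_add 1)
    obtain ⟨φ, rfl⟩ := Abelian.Ext.homEquiv₀.symm.surjective x
    obtain ⟨ψ, hψ⟩ := hlift φ.hom
    have h1 : ModuleCat.ofHom ψ ≫ ModuleCat.ofHom g = φ := by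
      rw [← ModuleCat.ofHom_comp, hψ]; rfl
    simp only [Abelian.Ext.homEquiv₀_symm_apply]
    rw [← h1, ← Abelian.Ext.mk₀_comp_mk₀, Abelian.Ext.comp_assoc_of_second_deg_zero]
    have := (shortExact hf hg h).comp_extClass
    simp only at this
    rw [this, Abelian.Ext.comp_zero]

end ExtVanishes

end Duality

section TorExt

variable {R : Type} [CommRing R]

section Shifting

variable {P : ℕ → Type} [∀ i, AddCommGroup (P i)] [∀ i, Module R (P i)]
  {M : Type} [AddCommGroup M] [Module R M] (d : ∀ i, P (i + 1) →ₗ[R] P i) {π : P 0 →ₗ[R] M}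
  (E : Type) [AddCommGroup E] [Module R E]

/-- The differential of `Hom(P, E)`. -/
def dualD (i : ℕ) : (P i →ₗ[R] E) →ₗ[R] (P (i + 1) →ₗ[R] E) := (d i).lcomp R E

variable {d}

lemma dualD_mem_ker (hd : ∀ i, Function.Exact (d (i + 1)) (d i)) (i : ℕ) (φ : P i →ₗ[R] E) :
    dualD d E i φ ∈ LinearMap.ker (dualD d E (i + 1)) := by
  change φ ∘ₗ d i ∘ₗ d (i + 1) = 0
  rw [(hd i).linearMap_comp_eq_zero, LinearMap.comp_zero]

variable [Module.Injective R E]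

lemma extVanishes_ker_dualD [∀ i, Module.Projective R (P i)]
    (hd : ∀ i, Function.Exact (d (i + 1)) (d i)) (X : Type) [AddCommGroup X] [Module R X]
    (i j : ℕ) :
    ExtVanishes R X (LinearMap.ker (dualD d E j)) (i + 1) ↔
      HomExact (d (i + j + 1)) (d (i + j)) (X →ₗ[R] E) := by
  have hinj (j : ℕ) : Module.Injective R (P j →ₗ[R] E) := injective_hom _ _
  let δ (j : ℕ) : (P j →ₗ[R] E) →ₗ[R] LinearMap.ker (dualD d E (j + 1)) :=
    (dualD d E j).codRestrict _ (dualD_mem_ker E hd j)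
  have hδ (j : ℕ) : Function.Surjective (δ j) := by
    rintro ⟨φ, hφ⟩
    obtain ⟨ψ, hψ⟩ := homExact_of_exact (hd j) φ hφ
    exact ⟨ψ, Subtype.ext hψ⟩
  have hex (j : ℕ) : Function.Exact (LinearMap.ker (dualD d E j)).subtype (δ j) := by
    rw [LinearMap.exact_iff, Submodule.range_subtype, LinearMap.ker_codRestrict]
  induction i generalizing j with
  | zero =>
    rw [zero_add, ExtVanishes.one_iff_of_injective (Submodule.injective_subtype _) (hδ j) (hex j),
      zero_add]
    constructor
    · intro h φ hφ
      obtain ⟨ψ, hψ⟩ := h (φ.flip.codRestrict _ fun x => by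
        change _ = _
        ext p
        exact congr($hφ p x))
      refine ⟨ψ.flip, ?_⟩
      ext p x
      exact congr(($hψ x).1 p)
    · intro h φ
      obtain ⟨ψ, hψ⟩ := h ((Submodule.subtype _ ∘ₗ φ).flip) (by
        ext p x
        exact congr($((φ x).2) p))
      refine ⟨ψ.flip, ?_⟩
      ext x p
      exact congr($hψ p x)
  | succ i ih =>
    refine (ExtVanishes.succ_iff_of_injective (Submodule.injective_subtype _) (hδ j)
      (hex j)).trans ((ih (j + 1)).trans ?_)
    rw [show i + (j + 1) = i + 1 + j by omega]

/-- `Ext(X, Hom(M, E))` computed from a projective resolution of `M`. -/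
lemma extVanishes_hom_iff [∀ i, Module.Projective R (P i)]
    (hd : ∀ i, Function.Exact (d (i + 1)) (d i)) (hπ : Function.Surjective π)
    (hdπ : Function.Exact (d 0) π) (X : Type) [AddCommGroup X] [Module R X] (i : ℕ) :
    ExtVanishes R X (M →ₗ[R] E) (i + 1) ↔ HomExact (d (i + 1)) (d i) (X →ₗ[R] E) := by
  let ι : (M →ₗ[R] E) →ₗ[R] LinearMap.ker (dualD d E 0) :=
    (π.lcomp R E).codRestrict _ fun φ => by
      change φ ∘ₗ π ∘ₗ d 0 = 0
      rw [hdπ.linearMap_comp_eq_zero, LinearMap.comp_zero]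
  have hι : Function.Bijective ι := by
    constructor
    · intro φ ψ h
      exact LinearMap.cancel_right hπ |>.1 congr(($h).1)
    · rintro ⟨φ, hφ⟩
      obtain ⟨ψ, hψ⟩ := homExact_of_exact hdπ φ hφ
      exact ⟨ψ, Subtype.ext hψ⟩
  let e := LinearEquiv.ofBijective ι hι
  exact Iff.trans ⟨ExtVanishes.congr_right e, ExtVanishes.congr_right e.symm⟩
    (extVanishes_ker_dualD E hd X i 0)

end Shifting

lemma subsingleton_torModule_succ_iff (n : ℕ) (X M : ModuleCat.{0} R)
    (P : ProjectiveResolution M) : Subsingleton (torModule R (n + 1) X M) ↔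
      Function.Exact ((P.complex.d (n + 2) (n + 1)).hom.lTensor X)
        ((P.complex.d (n + 1) n).hom.lTensor X) := by
  let F := (tensoringLeft (ModuleCat.{0} R)).obj X
  have e : torModule R (n + 1) X M ≅
      ((F.mapHomologicalComplex (ComplexShape.down ℕ)).obj P.complex).homology (n + 1) :=
    P.isoLeftDerivedObj F (n + 1)
  rw [← ModuleCat.isZero_iff_subsingleton, e.isZero_iff,
    ← HomologicalComplex.exactAt_iff_isZero_homology,
    HomologicalComplex.exactAt_iff' _ (n + 2) (n + 1) n (by simp) (by simp),
    ShortComplex.ShortExact.moduleCat_exact_iff_function_exact]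
  rfl

lemma subsingleton_torModule_zero_iff (X M : ModuleCat.{0} R) :
    Subsingleton (torModule R 0 X M) ↔ Subsingleton (TensorProduct R X M) := by
  let F := (tensoringLeft (ModuleCat.{0} R)).obj X
  have e : torModule R 0 X M ≅ F.obj M := F.leftDerivedZeroIsoSelf.app M
  rw [← ModuleCat.isZero_iff_subsingleton, e.isZero_iff, ModuleCat.isZero_iff_subsingleton]
  rfl

/-- Matlis-type duality between `Tor(X, M)` and `Ext(X, Hom(M, E))` for an injective
cogenerator `E`. -/
lemma subsingleton_torModule_iff (E : Type) [AddCommGroup E] [Module R E] [Module.Injective R E]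
    (hE : ∀ (X : Type) [AddCommGroup X] [Module R X] (x : X), x ≠ 0 → ∃ φ : X →ₗ[R] E, φ x ≠ 0)
    (X M : Type) [AddCommGroup X] [Module R X] [AddCommGroup M] [Module R M] (i : ℕ) :
    Subsingleton (torModule R i (ModuleCat.of R X) (ModuleCat.of R M)) ↔
      ExtVanishes R X (M →ₗ[R] E) i := by
  cases i with
  | zero =>
    rw [subsingleton_torModule_zero_iff, ExtVanishes.zero_iff,
      (TensorProduct.lift.equiv (.id R) X M E).toEquiv.subsingleton_congr]
    constructor
    · intro h
      change Subsingleton (TensorProduct R X M) at h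
      exact subsingleton_of_forall_eq 0 fun φ => LinearMap.ext fun x => by
        rw [h.elim x 0, map_zero, map_zero]
    · intro h
      refine subsingleton_of_forall_eq 0 fun x => ?_
      by_contra hx
      obtain ⟨φ, hφ⟩ := hE (TensorProduct R X M) x hx
      exact hφ (by rw [h.elim φ 0]; rfl)
  | succ n =>
    let P := projectiveResolution (ModuleCat.of R M)
    have hP (i : ℕ) : Module.Projective R (P.complex.X i) :=
      (IsProjective.iff_projective _).2 (P.projective i)
    have hd (i : ℕ) : Function.Exact (P.complex.d (i + 2) (i + 1)).hom
        (P.complex.d (i + 1) i).hom :=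
      (ShortComplex.ShortExact.moduleCat_exact_iff_function_exact _).1 (P.exact_succ i)
    let π : P.complex.X 0 →ₗ[R] M := (P.π.f 0).hom
    have hπ : Function.Surjective π :=
      (ModuleCat.epi_iff_surjective (P.π.f 0)).1 inferInstance
    have hdπ : Function.Exact (P.complex.d 1 0).hom π :=
      (ShortComplex.ShortExact.moduleCat_exact_iff_function_exact
        (ShortComplex.mk _ _ P.complex_d_comp_π_f_zero)).1
        (ShortComplex.exact_of_g_is_cokernel _ P.isColimitCokernelCofork)
    rw [subsingleton_torModule_succ_iff n _ _ P, ← exact_rTensor_iff_exact_lTensor,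
      extVanishes_hom_iff (P := fun i => P.complex.X i)
        (d := fun i => (P.complex.d (i + 1) i).hom) E hd hπ hdπ X n,
      homExact_hom_iff]
    refine ⟨homExact_of_exact, exact_of_homExact hE ?_⟩
    rw [← LinearMap.rTensor_comp, (hd n).linearMap_comp_eq_zero, LinearMap.rTensor_zero]

end TorExt

section Koszul

variable {R : Type} [CommRing R]

/-- A bounded complex of finite free modules, in degrees `≥ 1`, resembling the Koszul complex
on `l`: it starts with `R`, the first differential has image the ideal spanned by `l`, and the
members of `l` act null-homotopically. -/
structure KoszulType (l : List R) where
  K : ℕ → ModuleCat.{0} R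
  d : ∀ j, K (j + 1) →ₗ[R] K j
  free : ∀ j, Module.Free R (K j)
  finite : ∀ j, Module.Finite R (K j)
  subsingleton_zero : Subsingleton (K 0)
  d_comp_d : ∀ j v, d j (d (j + 1) v) = 0
  bounded : ∃ b, ∀ j, b ≤ j → Subsingleton (K j)
  homotopy : ∀ x ∈ l, ∃ h : ∀ j, K j →ₗ[R] K (j + 1),
    ∀ j v, d (j + 1) (h (j + 1) v) + h j (d j v) = x • v
  ε : K 1 →ₗ[R] R
  bijective_ε : Function.Bijective ε
  mem_span_iff : ∀ r, r ∈ Ideal.span {x | x ∈ l} ↔ ∃ v, ε (d 1 v) = r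

namespace KoszulType

/-- The complex for the empty list. -/
def nil : KoszulType ([] : List R) where
  K
    | 1 => ModuleCat.of R R
    | _ => ModuleCat.of R PUnit
  d _ := 0
  free
    | 0 => inferInstanceAs (Module.Free R PUnit)
    | 1 => inferInstanceAs (Module.Free R R)
    | _ + 2 => inferInstanceAs (Module.Free R PUnit)
  finite
    | 0 => inferInstanceAs (Module.Finite R PUnit)
    | 1 => inferInstanceAs (Module.Finite R R)
    | _ + 2 => inferInstanceAs (Module.Finite R PUnit)
  subsingleton_zero := inferInstanceAs (Subsingleton PUnit)
  d_comp_d _ _ := rfl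
  bounded := ⟨2, fun j hj => by
    obtain ⟨j, rfl⟩ := Nat.exists_eq_add_of_le' hj
    exact inferInstanceAs (Subsingleton PUnit)⟩
  homotopy x hx := by simp at hx
  ε := LinearMap.id
  bijective_ε := Function.bijective_id
  mem_span_iff r := by simp [eq_comm]

variable {l : List R} (C : KoszulType l) (x : R)

/-- The terms of the mapping cone of multiplication by an element. -/
def coneK : ℕ → ModuleCat.{0} R
  | 0 => C.K 0
  | j + 1 => ModuleCat.of R (C.K (j + 1) × C.K j)

/-- The differential of the mapping cone of multiplication by an element. -/
def coneD : ∀ j, C.coneK (j + 1) →ₗ[R] C.coneK j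
  | 0 => 0
  | j + 1 => LinearMap.prod ((C.d (j + 1)).coprod (x • LinearMap.id))
      (-(C.d j ∘ₗ LinearMap.snd R _ _))

/-- The null-homotopy of `x` on the mapping cone of multiplication by `x`. -/
def coneH : ∀ j, C.coneK j →ₗ[R] C.coneK (j + 1)
  | 0 => 0
  | j + 1 => LinearMap.prod 0 (LinearMap.fst R (C.K (j + 1)) (C.K j))

/-- The null-homotopy on the mapping cone induced by a null-homotopy. -/
def coneHomotopy (h : ∀ j, C.K j →ₗ[R] C.K (j + 1)) : ∀ j, C.coneK j →ₗ[R] C.coneK (j + 1)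
  | 0 => 0
  | j + 1 => LinearMap.prodMap (h (j + 1)) (-h j)

/-- The mapping cone of multiplication by an element. -/
def cons : KoszulType (x :: l) where
  K := C.coneK
  d := C.coneD x
  free
    | 0 => C.free 0
    | j + 1 => by
      have := C.free (j + 1)
      have := C.free j
      exact inferInstanceAs (Module.Free R (C.K (j + 1) × C.K j))
  finite
    | 0 => C.finite 0
    | j + 1 => by
      have := C.finite (j + 1)
      have := C.finite j
      exact inferInstanceAs (Module.Finite R (C.K (j + 1) × C.K j))
  subsingleton_zero := C.subsingleton_zero
  d_comp_d
    | 0, _ => rfl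
    | j + 1, (a, b) => by
      refine Prod.ext ?_ ?_
      · change C.d (j + 1) (C.d (j + 2) a + x • b) + x • (-C.d (j + 1) b) = 0
        rw [map_add, C.d_comp_d, map_smul, smul_neg, zero_add, add_neg_cancel]
      · change -C.d j (-C.d (j + 1) b) = 0
        rw [map_neg, C.d_comp_d, neg_zero, neg_zero]
  bounded := by
    obtain ⟨b, hb⟩ := C.bounded
    refine ⟨b + 1, fun j hj => ?_⟩
    obtain ⟨j, rfl⟩ := Nat.exists_eq_add_of_le' (show 1 ≤ j by omega)
    have := hb (j + 1) (by omega)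
    have := hb j (by omega)
    exact inferInstanceAs (Subsingleton (C.K (j + 1) × C.K j))
  homotopy y hy := by
    have h0 : ∀ v : C.K 0, v = 0 := fun v => C.subsingleton_zero.elim _ _
    rcases List.mem_cons.1 hy with rfl | hy
    · refine ⟨C.coneH, fun j => ?_⟩
      rcases j with - | j
      · rintro ⟨a, b⟩
        refine Prod.ext ?_ ((h0 _).trans (h0 _).symm)
        change C.d 1 0 + y • a + 0 = y • a
        rw [map_zero, zero_add, add_zero]
      · rintro ⟨a, b⟩
        refine Prod.ext ?_ ?_
        · change C.d (j + 2) 0 + y • a + 0 = y • a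
          rw [map_zero, zero_add, add_zero]
        · change -C.d (j + 1) a + (C.d (j + 1) a + y • b) = y • b
          rw [neg_add_cancel_left]
    · obtain ⟨h, hh⟩ := C.homotopy y hy
      refine ⟨C.coneHomotopy h, fun j => ?_⟩
      rcases j with - | j
      · rintro ⟨a, b⟩
        refine Prod.ext ?_ ((h0 _).trans (h0 _).symm)
        change C.d 1 (h 1 a) + x • (-h 0 b) + 0 = y • a
        rw [← hh 0 a, h0 b, h0 (C.d 0 a), map_zero, neg_zero, smul_zero, add_zero]
      · rintro ⟨a, b⟩
        refine Prod.ext ?_ ?_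
        · change C.d (j + 2) (h (j + 2) a) + x • (-h (j + 1) b) +
            h (j + 1) (C.d (j + 1) a + x • b) = y • a
          rw [← hh (j + 1) a, map_add, map_smul, smul_neg]
          abel
        · change -C.d (j + 1) (-h (j + 1) b) + -h j (-C.d j b) = y • b
          rw [← hh j b, map_neg, map_neg, neg_neg, neg_neg]
  ε := C.ε ∘ₗ LinearMap.fst R (C.K 1) (C.K 0)
  bijective_ε := by
    have := C.subsingleton_zero
    refine C.bijective_ε.comp ⟨fun p q h => Prod.ext h (Subsingleton.elim _ _), fun a => ?_⟩
    exact ⟨(a, 0), rfl⟩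
  mem_span_iff r := by
    have hset : {y | y ∈ x :: l} = insert x {y | y ∈ l} := by ext; simp
    rw [hset, Ideal.mem_span_insert]
    constructor
    · rintro ⟨a, z, hz, rfl⟩
      obtain ⟨v, rfl⟩ := (C.mem_span_iff z).1 hz
      obtain ⟨b, rfl⟩ := C.bijective_ε.2 a
      refine ⟨(v, b), ?_⟩
      change C.ε (C.d 1 v + x • b) = _
      rw [map_add, map_smul, smul_eq_mul, mul_comm, add_comm]
    · rintro ⟨⟨v, b⟩, rfl⟩
      refine ⟨C.ε b, C.ε (C.d 1 v), (C.mem_span_iff _).2 ⟨v, rfl⟩, ?_⟩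
      change C.ε (C.d 1 v + x • b) = _
      rw [map_add, map_smul, smul_eq_mul, mul_comm, add_comm]

lemma nonempty (l : List R) : Nonempty (KoszulType l) := by
  induction l with
  | nil => exact ⟨nil⟩
  | cons x l ih => exact ih.map fun C => C.cons x

end KoszulType

end Koszul

section Homology

variable {R : Type} [CommRing R] {A B C N : Type} [AddCommGroup A] [Module R A] [AddCommGroup B]
  [Module R B] [AddCommGroup C] [Module R C] [AddCommGroup N] [Module R N]
  (f : A →ₗ[R] B) (g : B →ₗ[R] C) (hfg : ∀ a, g (f a) = 0)

/-- The map `B ⧸ im f → C` induced by `g` when `g ∘ f = 0`. -/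
def cokerDesc : (B ⧸ LinearMap.range f) →ₗ[R] C :=
  (LinearMap.range f).liftQ g (by rintro _ ⟨a, rfl⟩; exact hfg a)

/-- The homology of `A → B → C`, as a submodule of the cokernel of the first map. -/
abbrev Homology : Submodule R (B ⧸ LinearMap.range f) := LinearMap.ker (cokerDesc f g hfg)

variable {f g}

lemma range_cokerDesc : LinearMap.range (cokerDesc f g hfg) = LinearMap.range g :=
  Submodule.range_liftQ _ _ _

/-- The surjection from the cokernel of `f` onto the image of `g`. -/
def cokerToRange : (B ⧸ LinearMap.range f) →ₗ[R] LinearMap.range g :=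
  (cokerDesc f g hfg).codRestrict _ fun x => by
    rw [← range_cokerDesc hfg]; exact LinearMap.mem_range_self _ _

lemma cokerToRange_surjective : Function.Surjective (cokerToRange hfg) := by
  rintro ⟨_, b, rfl⟩
  exact ⟨(LinearMap.range f).mkQ b, rfl⟩

lemma exact_homology_cokerToRange :
    Function.Exact (Homology f g hfg).subtype (cokerToRange hfg) := by
  rw [LinearMap.exact_iff, Submodule.range_subtype, cokerToRange, LinearMap.ker_codRestrict]

lemma Homology.smul_eq_zero {x : R} (hx : ∀ b, g b = 0 → x • b ∈ LinearMap.range f)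
    (v : Homology f g hfg) : x • v = 0 := by
  obtain ⟨v, hv⟩ := v
  obtain ⟨b, rfl⟩ := Submodule.mkQ_surjective _ v
  ext
  rw [Submodule.coe_smul, ← map_smul]
  exact (Submodule.Quotient.mk_eq_zero _).2 (hx b hv)

lemma exists_factor_range (hH : ExtVanishes R (Homology f g hfg) N 0) (φ : B →ₗ[R] N)
    (hφ : φ ∘ₗ f = 0) : ∃ χ : LinearMap.range g →ₗ[R] N, χ ∘ₗ g.rangeRestrict = φ := by
  have hker : ∀ b, g b = 0 → φ b = 0 := fun b hb => by
    have h0 := (ExtVanishes.zero_iff.1 hH).elim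
      (cokerDesc f φ (fun a => congr($hφ a)) ∘ₗ (Homology f g hfg).subtype) 0
    exact congr($h0 ⟨(LinearMap.range f).mkQ b, hb⟩)
  refine ⟨(LinearMap.ker g).liftQ φ hker ∘ₗ g.quotKerEquivRange.symm.toLinearMap, ?_⟩
  ext b
  have : g.quotKerEquivRange.symm (g.rangeRestrict b) = (LinearMap.ker g).mkQ b := by
    rw [LinearEquiv.symm_apply_eq]; rfl
  simp only [LinearMap.comp_apply, LinearEquiv.coe_coe, this]
  rfl

lemma homExact_of_extVanishes (hH : ExtVanishes R (Homology f g hfg) N 0)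
    (h : ExtVanishes R (C ⧸ LinearMap.range g) N 1) : HomExact f g N := by
  intro φ hφ
  obtain ⟨χ, rfl⟩ := exists_factor_range hfg hH φ hφ
  obtain ⟨ψ, rfl⟩ := ExtVanishes.exists_extension (LinearMap.range g).injective_subtype
    (LinearMap.range g).mkQ_surjective (LinearMap.exact_subtype_mkQ _) h χ
  exact ⟨ψ, rfl⟩

include hfg in
lemma extVanishes_of_homExact [Module.Projective R C] (h : HomExact f g N) :
    ExtVanishes R (C ⧸ LinearMap.range g) N 1 := by
  refine ExtVanishes.one_of_extension (LinearMap.range g).injective_subtype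
    (LinearMap.range g).mkQ_surjective (LinearMap.exact_subtype_mkQ _)
    ExtVanishes.of_projective fun φ => ?_
  obtain ⟨ψ, hψ⟩ := h (φ ∘ₗ g.rangeRestrict) (by
    ext a
    have : g.rangeRestrict (f a) = 0 := Subtype.ext (hfg a)
    simp only [LinearMap.comp_apply, this, map_zero, LinearMap.zero_apply])
  refine ⟨ψ, ?_⟩
  ext ⟨_, b, rfl⟩
  exact congr($hψ b)

lemma extVanishes_coker_of_succ [Module.Projective R C] {i : ℕ}
    (hH : ExtVanishes R (Homology f g hfg) N (i + 1))
    (h : ExtVanishes R (C ⧸ LinearMap.range g) N (i + 2)) :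
    ExtVanishes R (B ⧸ LinearMap.range f) N (i + 1) :=
  ExtVanishes.middle (Submodule.injective_subtype _) (cokerToRange_surjective hfg)
    (exact_homology_cokerToRange hfg) hH
    (ExtVanishes.left (LinearMap.range g).injective_subtype
      (LinearMap.range g).mkQ_surjective (LinearMap.exact_subtype_mkQ _)
      ExtVanishes.of_projective h)

lemma extVanishes_coker_succ [Module.Projective R C] {i : ℕ}
    (hH : ExtVanishes R (Homology f g hfg) N i)
    (h : ExtVanishes R (B ⧸ LinearMap.range f) N (i + 1)) :
    ExtVanishes R (C ⧸ LinearMap.range g) N (i + 2) :=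
  ExtVanishes.right (LinearMap.range g).injective_subtype
    (LinearMap.range g).mkQ_surjective (LinearMap.exact_subtype_mkQ _)
    (ExtVanishes.right (Submodule.injective_subtype _) (cokerToRange_surjective hfg)
      (exact_homology_cokerToRange hfg) hH h) ExtVanishes.of_projective

end Homology

section Depth

open IsLocalRing

variable {R : Type} [CommRing R] [IsNoetherianRing R] [IsLocalRing R]
  {l : List R} (C : KoszulType l) (hl : Ideal.span {x | x ∈ l} = maximalIdeal R)
  {M : Type} [AddCommGroup M] [Module R M]

namespace KoszulType

instance (j : ℕ) : Module.Free R (C.K j) := C.free j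
instance (j : ℕ) : Module.Finite R (C.K j) := C.finite j

include hl

omit [IsNoetherianRing R] in
lemma smul_mem_range {j : ℕ} {r : R} (hr : r ∈ maximalIdeal R) (v : C.K (j + 1))
    (hv : C.d j v = 0) : r • v ∈ LinearMap.range (C.d (j + 1)) := by
  rw [← hl] at hr
  induction hr using Submodule.span_induction with
  | mem x hx =>
    obtain ⟨h, hh⟩ := C.homotopy x hx
    exact ⟨h (j + 1) v, by rw [← hh j v, hv, map_zero, add_zero]⟩
  | zero => rw [zero_smul]; exact Submodule.zero_mem _
  | add x y _ _ hx hy => rw [add_smul]; exact Submodule.add_mem _ hx hy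
  | smul a x _ hx => rw [smul_eq_mul, mul_smul]; exact Submodule.smul_mem _ a hx

lemma extVanishes_homology {i j : ℕ} (h : ExtVanishes R (ResidueField R) M i) :
    ExtVanishes R (Homology (C.d (j + 1)) (C.d j) (C.d_comp_d j)) M i :=
  ExtVanishes.of_residueField
    (fun _ hr => Homology.smul_eq_zero _ fun v hv => C.smul_mem_range hl hr v hv) h

omit [IsNoetherianRing R] in
/-- The zeroth homology of the complex is the residue field. -/
lemma nonempty_equiv_residueField :
    Nonempty ((C.K 1 ⧸ LinearMap.range (C.d 1)) ≃ₗ[R] ResidueField R) := by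
  refine ⟨Submodule.Quotient.equiv _ _ (LinearEquiv.ofBijective C.ε C.bijective_ε) ?_⟩
  ext r
  rw [← hl, C.mem_span_iff]
  simp only [Submodule.mem_map, LinearMap.mem_range, exists_exists_eq_and]
  rfl

omit [IsNoetherianRing R] in
lemma homExact_zero_iff : HomExact (C.d 1) (C.d 0) M ↔ ExtVanishes R (ResidueField R) M 0 := by
  have h0 := C.subsingleton_zero
  obtain ⟨e⟩ := C.nonempty_equiv_residueField hl
  rw [← ExtVanishes.congr e, ExtVanishes.zero_iff]
  constructor
  · intro h
    refine subsingleton_of_forall_eq 0 fun φ => ?_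
    obtain ⟨ψ, hψ⟩ := h (φ ∘ₗ Submodule.mkQ _)
      (by rw [LinearMap.comp_assoc, LinearMap.range_mkQ_comp, LinearMap.comp_zero])
    apply Submodule.linearMap_qext
    rw [← hψ]
    ext v
    rw [LinearMap.comp_apply, h0.elim (C.d 0 v) 0, map_zero]
    rfl
  · intro h φ hφ
    refine ⟨0, ?_⟩
    have h1 := h.elim ((LinearMap.range (C.d 1)).liftQ φ
      (LinearMap.range_le_ker_iff.2 hφ)) 0
    ext v
    exact congr($h1 (Submodule.Quotient.mk v)).symm

/-- The first nonvanishing `Ext(k, M)` is detected by the complex. -/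
lemma homExact_iff_extVanishes (j : ℕ) (h : ∀ i < j, ExtVanishes R (ResidueField R) M i) :
    HomExact (C.d (j + 1)) (C.d j) M ↔ ExtVanishes R (ResidueField R) M j := by
  cases j with
  | zero => exact C.homExact_zero_iff hl
  | succ j =>
    have key (a b : ℕ) (hab : a + b = j) :
        ExtVanishes R (C.K (b + 1) ⧸ LinearMap.range (C.d (b + 1))) M (a + 1) ↔
          ExtVanishes R (C.K 1 ⧸ LinearMap.range (C.d 1)) M (j + 1) := by
      induction b generalizing a with
      | zero => rw [← hab, add_zero]
      | succ b ih =>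
        rw [← ih (a + 1) (by omega)]
        exact ⟨extVanishes_coker_succ (C.d_comp_d _) (C.extVanishes_homology hl (h a (by omega))),
          extVanishes_coker_of_succ (C.d_comp_d _)
            (C.extVanishes_homology hl (h (a + 1) (by omega)))⟩
    obtain ⟨e⟩ := C.nonempty_equiv_residueField hl
    rw [← ExtVanishes.congr e, ← key 0 j (zero_add j)]
    exact ⟨extVanishes_of_homExact (C.d_comp_d _),
      homExact_of_extVanishes (C.d_comp_d _) (C.extVanishes_homology hl (h 0 (by omega)))⟩

end KoszulType

end Depth

section CochainComplex

open IsLocalRing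

variable {R : Type} [CommRing R] {D : ℕ → Type} [∀ j, AddCommGroup (D j)] [∀ j, Module R (D j)]
  [∀ j, Module.Projective R (D j)]
  {δ : ∀ j, D j →ₗ[R] D (j + 1)} (hδ : ∀ j v, δ (j + 1) (δ j v) = 0)
  (hb : ∃ b, ∀ j, b ≤ j → Subsingleton (D j))
  {N : Type} [AddCommGroup N] [Module R N]

include hb in
lemma extVanishes_coker_of_lt {s : ℕ}
    (hH : ∀ i j, s < i → ExtVanishes R (Homology (δ j) (δ (j + 1)) (hδ j)) N i)
    {i : ℕ} (hi : s < i) (j : ℕ) :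
    ExtVanishes R (D (j + 1) ⧸ LinearMap.range (δ j)) N i := by
  obtain ⟨b, hb⟩ := hb
  suffices ∀ t i j, s < i → b ≤ j + 1 + t →
      ExtVanishes R (D (j + 1) ⧸ LinearMap.range (δ j)) N i from
    this b i j hi (by omega)
  intro t
  induction t with
  | zero =>
    intro i j _ hj
    have := hb _ hj
    exact ExtVanishes.of_subsingleton
  | succ t ih =>
    intro i j hi hj
    obtain ⟨i, rfl⟩ := Nat.exists_eq_add_of_le' (Nat.one_le_of_lt hi)
    exact extVanishes_coker_of_succ (hδ j) (hH _ j hi) (ih _ (j + 1) (by omega) (by omega))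

include hb in
lemma homExact_of_extVanishes_homology
    (hH : ∀ i j, ExtVanishes R (Homology (δ j) (δ (j + 1)) (hδ j)) N i) (j : ℕ) :
    HomExact (δ j) (δ (j + 1)) N :=
  homExact_of_extVanishes (hδ j) (hH 0 j)
    (extVanishes_coker_of_lt (s := 0) hδ hb (fun i j _ => hH i j) one_pos (j + 1))

variable {d : ℕ} (hd : ∀ j < d, Subsingleton (Homology (δ j) (δ (j + 1)) (hδ j)))

include hd in
lemma extVanishes_coker_iff_of_add_eq {t j : ℕ} (h : j + t = d) (i : ℕ) :
    ExtVanishes R (D (j + 1) ⧸ LinearMap.range (δ j)) N (i + 1) ↔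
      ExtVanishes R (D (d + 1) ⧸ LinearMap.range (δ d)) N (i + t + 1) := by
  induction t generalizing i j with
  | zero => obtain rfl : j = d := h; rfl
  | succ t ih =>
    have := hd j (by omega)
    rw [add_comm t, ← add_assoc, ← ih (j := j + 1) (by omega)]
    exact ⟨extVanishes_coker_succ (hδ j) .of_subsingleton,
      extVanishes_coker_of_succ (hδ j) .of_subsingleton⟩

variable [IsNoetherianRing R] [IsLocalRing R] [∀ j, Module.Finite R (D j)]
  (hm : ∀ r ∈ maximalIdeal R, ∀ j v, δ (j + 1) v = 0 → r • v ∈ LinearMap.range (δ j))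

omit [∀ j, Module.Projective R (D j)] in
include hm in
lemma extVanishes_homology_of_residueField {i : ℕ} (j : ℕ)
    (h : ExtVanishes R (ResidueField R) N i) :
    ExtVanishes R (Homology (δ j) (δ (j + 1)) (hδ j)) N i :=
  ExtVanishes.of_residueField (fun r hr => Homology.smul_eq_zero _ (hm r hr j)) h

variable {s : ℕ} (hs : ∀ i, s < i → ExtVanishes R (ResidueField R) N i)

include hδ hb hm hs in
lemma extVanishes_range_succ (j : ℕ) :
    ExtVanishes R (LinearMap.range (δ j)) N (s + 1) :=
  ExtVanishes.left (LinearMap.range (δ j)).injective_subtype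
    (LinearMap.range (δ j)).mkQ_surjective (LinearMap.exact_subtype_mkQ _)
    ExtVanishes.of_projective
    (extVanishes_coker_of_lt hδ hb
      (fun i j hi => extVanishes_homology_of_residueField hδ hm j (hs i hi)) (by omega) j)

variable (hs' : ¬ ExtVanishes R (ResidueField R) N s)
  (hd' : Nontrivial (Homology (δ d) (δ (d + 1)) (hδ d)))

omit [∀ j, Module.Projective R (D j)] in
include hm hs' hd' in
lemma not_extVanishes_homology :
    ¬ ExtVanishes R (Homology (δ d) (δ (d + 1)) (hδ d)) N s := fun h =>
  hs' (ExtVanishes.residueField_of_nontrivial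
    (fun r hr => Homology.smul_eq_zero _ (hm r hr d)) h)

include hb hm hs hs' hd' in
lemma not_extVanishes_coker :
    ¬ ExtVanishes R (D (d + 1) ⧸ LinearMap.range (δ d)) N s := fun h =>
  not_extVanishes_homology hδ hm hs' hd'
    (ExtVanishes.left (Submodule.injective_subtype _) (cokerToRange_surjective (hδ d))
      (exact_homology_cokerToRange (hδ d)) h (extVanishes_range_succ hδ hb hm hs (d + 1)))

include hb hm hs hs' hd' in
lemma not_homExact_of_eq_zero (h0 : s = 0) : ¬ HomExact (δ d) (δ (d + 1)) N := by
  subst h0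
  refine fun h => not_extVanishes_homology hδ hm hs' hd' (ExtVanishes.zero_iff.2
    (subsingleton_of_forall_eq 0 fun χ => ?_))
  obtain ⟨φ, rfl⟩ := ExtVanishes.exists_extension (Submodule.injective_subtype _)
    (cokerToRange_surjective (hδ d)) (exact_homology_cokerToRange (hδ d))
    (extVanishes_range_succ hδ hb hm hs (d + 1)) χ
  obtain ⟨ψ, hψ⟩ := h (φ ∘ₗ (LinearMap.range (δ d)).mkQ)
    (by rw [LinearMap.comp_assoc, LinearMap.range_mkQ_comp, LinearMap.comp_zero])
  ext ⟨v, hv⟩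
  obtain ⟨b, rfl⟩ := Submodule.mkQ_surjective _ v
  have hb : δ (d + 1) b = 0 := hv
  change (φ ∘ₗ (LinearMap.range (δ d)).mkQ) b = 0
  rw [← hψ, LinearMap.comp_apply, hb, map_zero]

include hd hb hm hs hs' hd' in
/-- For a bounded complex `D` of finite free modules whose homology is killed by the maximal
ideal and starts in degree `d`, the homology of `Hom(D, N)` starts `s` places earlier, where
`s` is the largest index with `Ext^s(k, N) ≠ 0`. -/
lemma exists_first_not_homExact (h0 : Subsingleton (D 0)) :
    ∃ e, e + s = d ∧ ¬ HomExact (δ e) (δ (e + 1)) N ∧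
      ∀ j < e, HomExact (δ j) (δ (j + 1)) N := by
  have hQ {i : ℕ} (hi : s < i) (j : ℕ) :=
    extVanishes_coker_of_lt hδ hb
      (fun i j hi => extVanishes_homology_of_residueField hδ hm j (hs i hi)) hi j
  have hnot := not_extVanishes_coker hδ hb hm hs hs' hd'
  have hlow {e : ℕ} (he : e + s = d) (j : ℕ) (hj : j < e) : HomExact (δ j) (δ (j + 1)) N := by
    have := hd j (by omega)
    refine homExact_of_extVanishes (hδ j) .of_subsingleton ?_
    obtain ⟨t, ht⟩ := Nat.exists_eq_add_of_le (show j + 1 ≤ d by omega)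
    exact (extVanishes_coker_iff_of_add_eq hδ hd ht.symm 0).2 (hQ (by omega) d)
  obtain _ | s := s
  · exact ⟨d, rfl, not_homExact_of_eq_zero hδ hb hm hs hs' hd' rfl, hlow rfl⟩
  · have hle : s + 1 ≤ d := by
      by_contra hlt
      obtain ⟨t, ht⟩ := Nat.exists_eq_add_of_le (show d ≤ s by omega)
      have hbot : LinearMap.range (δ 0) = ⊥ := by
        rw [LinearMap.range_eq_bot]
        exact LinearMap.ext fun v => by rw [h0.elim v 0, map_zero, map_zero]
      have := (extVanishes_coker_iff_of_add_eq (N := N) hδ hd (zero_add d) t).1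
        ((ExtVanishes.congr (Submodule.quotEquivOfEqBot _ hbot)).2 .of_projective)
      rw [add_comm t, ← ht] at this
      exact hnot this
    obtain ⟨e, rfl⟩ := Nat.exists_eq_add_of_le' hle
    refine ⟨e, rfl, fun h => hnot ?_, hlow rfl⟩
    have := hd e (by omega)
    have := (extVanishes_coker_iff_of_add_eq (N := N) hδ hd
      (show e + 1 + s = e + (s + 1) by omega) 0).1 (extVanishes_of_homExact (hδ e) h)
    rwa [zero_add] at this

end CochainComplex

namespace KoszulType

open IsLocalRing

variable {R : Type} [CommRing R] {l : List R} (C : KoszulType l)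
  {M : Type} [AddCommGroup M] [Module R M]

/-- The differential of the dual complex. -/
def dualDiff (j : ℕ) : Module.Dual R (C.K j) →ₗ[R] Module.Dual R (C.K (j + 1)) :=
  (C.d j).lcomp R R

lemma dualDiff_dualDiff (j : ℕ) (φ : Module.Dual R (C.K j)) :
    C.dualDiff (j + 1) (C.dualDiff j φ) = 0 := by
  ext v
  exact (congrArg φ (C.d_comp_d j v)).trans (map_zero φ)

lemma bounded_dual : ∃ b, ∀ j, b ≤ j → Subsingleton (Module.Dual R (C.K j)) := by
  obtain ⟨b, hb⟩ := C.bounded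
  exact ⟨b, fun j hj => have := hb j hj; inferInstance⟩

lemma smul_mem_range_dualDiff [IsLocalRing R] (hl : Ideal.span {x | x ∈ l} = maximalIdeal R)
    (r : R) (hr : r ∈ maximalIdeal R) (j : ℕ) (φ : Module.Dual R (C.K (j + 1)))
    (hφ : C.dualDiff (j + 1) φ = 0) : r • φ ∈ LinearMap.range (C.dualDiff j) := by
  rw [← hl] at hr
  induction hr using Submodule.span_induction with
  | mem x hx =>
    obtain ⟨h, hh⟩ := C.homotopy x hx
    refine ⟨φ ∘ₗ h j, ?_⟩
    ext v
    have h1 : φ (C.d (j + 1) (h (j + 1) v)) = 0 := congr($hφ (h (j + 1) v))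
    have h2 := congrArg φ (hh j v)
    rwa [map_add, h1, zero_add, map_smul] at h2
  | zero => rw [zero_smul]; exact Submodule.zero_mem _
  | add x y _ _ hx hy => rw [add_smul]; exact Submodule.add_mem _ hx hy
  | smul a x _ hx => rw [smul_eq_mul, mul_smul]; exact Submodule.smul_mem _ a hx

lemma exact_lcomp_iff (j : ℕ) :
    Function.Exact ((C.d j).lcomp R M) ((C.d (j + 1)).lcomp R M) ↔
      HomExact (C.d (j + 1)) (C.d j) M := by
  refine ⟨fun h φ hφ => (h φ).1 hφ, fun h φ => ⟨fun hφ => h φ hφ, ?_⟩⟩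
  rintro ⟨ψ, rfl⟩
  ext v
  exact (congrArg ψ (C.d_comp_d j v)).trans (map_zero ψ)

lemma exact_rTensor_dualDiff_iff (j : ℕ) :
    Function.Exact ((C.dualDiff j).rTensor M) ((C.dualDiff (j + 1)).rTensor M) ↔
      HomExact (C.d (j + 1)) (C.d j) M := by
  rw [← C.exact_lcomp_iff]
  refine (Function.Exact.iff_of_ladder_linearEquiv (e₁ := dualTensorHomEquiv R (C.K j) M)
    (e₂ := dualTensorHomEquiv R (C.K (j + 1)) M) (e₃ := dualTensorHomEquiv R (C.K (j + 2)) M)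
    ?_ ?_).symm
  · refine TensorProduct.ext' fun φ m => ?_
    ext v
    simp [dualDiff]
  · refine TensorProduct.ext' fun φ m => ?_
    ext v
    simp [dualDiff]

lemma homExact_dualDiff_iff {E : Type} [AddCommGroup E] [Module R E] [Module.Injective R E]
    (hE : ∀ (X : Type) [AddCommGroup X] [Module R X] (x : X), x ≠ 0 → ∃ φ : X →ₗ[R] E, φ x ≠ 0)
    (j : ℕ) : HomExact (C.dualDiff j) (C.dualDiff (j + 1)) (M →ₗ[R] E) ↔
      HomExact (C.d (j + 1)) (C.d j) M := by
  rw [homExact_hom_iff, ← C.exact_rTensor_dualDiff_iff]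
  refine ⟨exact_of_homExact hE ?_, fun h => homExact_of_exact h⟩
  have hcomp : C.dualDiff (j + 1) ∘ₗ C.dualDiff j = 0 := LinearMap.ext (C.dualDiff_dualDiff j)
  rw [← LinearMap.rTensor_comp, hcomp, LinearMap.rTensor_zero]

lemma subsingleton_homology_dualDiff_iff (j : ℕ) :
    Subsingleton (Homology (C.dualDiff j) (C.dualDiff (j + 1)) (C.dualDiff_dualDiff j)) ↔
      HomExact (C.d (j + 1)) (C.d j) R := by
  rw [← C.exact_lcomp_iff, Submodule.subsingleton_iff_eq_bot]
  constructor
  · intro h φ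
    refine ⟨fun hφ => ?_, ?_⟩
    · have : (LinearMap.range (C.dualDiff j)).mkQ φ ∈
          Homology (C.dualDiff j) (C.dualDiff (j + 1)) (C.dualDiff_dualDiff j) := hφ
      rw [h, Submodule.mem_bot, Submodule.mkQ_apply, Submodule.Quotient.mk_eq_zero] at this
      exact this
    · rintro ⟨ψ, rfl⟩
      exact C.dualDiff_dualDiff j ψ
  · intro h
    rw [eq_bot_iff]
    intro v hv
    obtain ⟨φ, rfl⟩ := Submodule.mkQ_surjective _ v
    exact (Submodule.Quotient.mk_eq_zero _).2 ((h φ).1 hv)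

end KoszulType

section Main

open IsLocalRing

variable {R : Type} [CommRing R]

/-- An injective module containing the residue field is a cogenerator. -/
lemma exists_apply_ne_zero [IsLocalRing R] {E : Type} [AddCommGroup E] [Module R E]
    [Module.Injective R E] (f : ResidueField R →ₗ[R] E) (hf : Function.Injective f)
    (X : Type) [AddCommGroup X] [Module R X] (x : X) (hx : x ≠ 0) :
    ∃ φ : X →ₗ[R] E, φ x ≠ 0 := by
  let t := LinearMap.toSpanSingleton R X x
  have hle : LinearMap.ker t ≤ LinearMap.ker (Algebra.linearMap R (ResidueField R)) := by
    intro r hr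
    rw [LinearMap.mem_ker, Algebra.linearMap_apply, ResidueField.algebraMap_eq,
      residue_eq_zero_iff]
    refine (mem_maximalIdeal r).2 fun hu => hx ?_
    exact hu.smul_eq_zero.1 hr
  obtain ⟨φ, hφ⟩ := Module.Injective.extension_property R E _ _
    ((LinearMap.ker t).liftQ t le_rfl)
    (LinearMap.ker_eq_bot.1 (Submodule.ker_liftQ_eq_bot' _ _ rfl))
    (f ∘ₗ (LinearMap.ker t).liftQ _ hle)
  refine ⟨φ, fun h0 => ?_⟩
  have h1 : φ (t 1) = f (algebraMap R (ResidueField R) 1) :=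
    congr($hφ ((LinearMap.ker t).mkQ 1))
  rw [LinearMap.toSpanSingleton_apply, one_smul, h0, map_one, ← map_zero f] at h1
  exact one_ne_zero (hf h1).symm

lemma edepth_eq {X M : Type} [AddCommGroup X] [Module R X] [AddCommGroup M] [Module R M] {e : ℕ}
    (h : ∀ i < e, ExtVanishes R X M i) (he : ¬ ExtVanishes R X M e) :
    edepth R (ModuleCat.of R X) (ModuleCat.of R M) = e := by
  refine le_antisymm (sInf_le ⟨e, rfl, ?_⟩) (le_sInf ?_)
  · rwa [← not_subsingleton_iff_nontrivial, subsingleton_extModule_iff]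
  · rintro _ ⟨i, rfl, hi⟩
    rw [← not_subsingleton_iff_nontrivial, subsingleton_extModule_iff] at hi
    by_contra hlt
    exact hi (h i (by simpa using hlt))

lemma edepth_eq_top {X M : Type} [AddCommGroup X] [Module R X] [AddCommGroup M] [Module R M]
    (h : ∀ i, ExtVanishes R X M i) : edepth R (ModuleCat.of R X) (ModuleCat.of R M) = ⊤ := by
  refine sInf_eq_top.2 ?_
  rintro _ ⟨i, rfl, hi⟩
  rw [← not_subsingleton_iff_nontrivial, subsingleton_extModule_iff] at hi
  exact absurd (h i) hi

namespace KoszulType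

variable [IsNoetherianRing R] [IsLocalRing R] {l : List R} (C : KoszulType l)
  (hl : Ideal.span {x | x ∈ l} = maximalIdeal R) {M : Type} [AddCommGroup M] [Module R M]

include hl

lemma extVanishes_of_forall_homExact {e : ℕ}
    (h : ∀ j < e, HomExact (C.d (j + 1)) (C.d j) M) :
    ∀ j < e, ExtVanishes R (ResidueField R) M j := by
  intro j
  induction j using Nat.strong_induction_on with
  | _ j ih =>
    exact fun hj => (C.homExact_iff_extVanishes hl j fun i hi => ih i hi (hi.trans hj)).1 (h j hj)

lemma edepth_eq {e : ℕ} (h : ∀ j < e, HomExact (C.d (j + 1)) (C.d j) M)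
    (he : ¬ HomExact (C.d (e + 1)) (C.d e) M) :
    edepth R (ModuleCat.of R (ResidueField R)) (ModuleCat.of R M) = e := by
  have h' := C.extVanishes_of_forall_homExact hl h
  exact _root_.edepth_eq h' (by rwa [← C.homExact_iff_extVanishes hl e h'])

lemma exists_not_homExact {E : Type} [AddCommGroup E] [Module R E] [Module.Injective R E]
    (hE : ∀ (X : Type) [AddCommGroup X] [Module R X] (x : X), x ≠ 0 →
      ∃ φ : X →ₗ[R] E, φ x ≠ 0) : ∃ j, ¬ HomExact (C.d (j + 1)) (C.d j) R := by
  by_contra! h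
  have h0 := homExact_of_extVanishes_homology (N := ResidueField R →ₗ[R] E) C.dualDiff_dualDiff
    C.bounded_dual (fun i j => by
      have := (C.subsingleton_homology_dualDiff_iff j).2 (h j)
      exact ExtVanishes.of_subsingleton) 0
  rw [C.homExact_dualDiff_iff hE, C.homExact_zero_iff hl, ExtVanishes.zero_iff] at h0
  exact one_ne_zero congr($(h0.elim LinearMap.id 0) (1 : ResidueField R))

end KoszulType

end Main

/-- `(R, m, k)` local noetherian, `E = E(k)` the injective envelope of `k`
(an injective module containing `k` as an essential submodule). If `Tor_n^R(k, M) = 0` and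
`H^i_m(Hom_R(M, E)) = 0` for all `i > n`, then `Tor_i^R(k, M) = 0` for all `i ≥ n`, and
`sup{ i : Tor_i^R(k, M) ≠ 0 } = depth R - depth_R M`. -/
theorem tor_rigidity_of_localCohomology_dual_vanishing
    (R : Type) [CommRing R] [IsNoetherianRing R] [IsLocalRing R]
    (E : Type) [AddCommGroup E] [Module R E]
    (hEinj : Module.Injective R E)
    (f : IsLocalRing.ResidueField R →ₗ[R] E)
    (hf : Function.Injective f)
    (hess : ∀ N : Submodule R E, N ≠ ⊥ → N ⊓ LinearMap.range f ≠ ⊥)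
    (M : Type) [AddCommGroup M] [Module R M] (n : ℕ)
    (hvan : Subsingleton (torModule R n
      (ModuleCat.of R (IsLocalRing.ResidueField R)) (ModuleCat.of R M)))
    (hlc : ∀ i : ℕ, n < i → Subsingleton
      ((localCohomology (IsLocalRing.maximalIdeal R) i).obj (ModuleCat.of R (M →ₗ[R] E)))) :
    (∀ i : ℕ, n ≤ i → Subsingleton (torModule R i
      (ModuleCat.of R (IsLocalRing.ResidueField R)) (ModuleCat.of R M))) ∧
    torSup R (ModuleCat.of R (IsLocalRing.ResidueField R)) (ModuleCat.of R M)
      = edepth R (ModuleCat.of R (IsLocalRing.ResidueField R)) (ModuleCat.of R R)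
        - edepth R (ModuleCat.of R (IsLocalRing.ResidueField R)) (ModuleCat.of R M) := by
  have hE := exists_apply_ne_zero f hf
  have hTor (i : ℕ) := subsingleton_torModule_iff E hE (IsLocalRing.ResidueField R) M i
  have hExt (i : ℕ) (hi : n ≤ i) :
      ExtVanishes R (IsLocalRing.ResidueField R) (M →ₗ[R] E) i := by
    induction i, hi using Nat.le_induction with
    | base => exact (hTor n).1 hvan
    | succ i hi ih => exact ih.succ_of_localCohomology (hlc (i + 1) (by omega))
  refine ⟨fun i hi => (hTor i).2 (hExt i hi), ?_⟩
  obtain ⟨s, hs⟩ := (isNoetherianRing_iff_ideal_fg R).1 inferInstance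
    (IsLocalRing.maximalIdeal R)
  have hl : Ideal.span {x | x ∈ s.toList} = IsLocalRing.maximalIdeal R := by
    simp only [Finset.mem_toList]
    exact hs
  obtain ⟨C⟩ := KoszulType.nonempty s.toList
  classical
  have hex := C.exists_not_homExact hl hE
  let d := Nat.find hex
  have hd (j : ℕ) (hj : j < d) : HomExact (C.d (j + 1)) (C.d j) R :=
    not_not.1 (Nat.find_min hex hj)
  have hd' : ¬ HomExact (C.d (d + 1)) (C.d d) R := Nat.find_spec hex
  rw [C.edepth_eq hl hd hd']
  have hm := C.smul_mem_range_dualDiff hl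
  by_cases hall : ∀ i, ExtVanishes R (IsLocalRing.ResidueField R) (M →ₗ[R] E) i
  · have hM (j : ℕ) : HomExact (C.d (j + 1)) (C.d j) M :=
      (C.homExact_dualDiff_iff hE j).1 (homExact_of_extVanishes_homology C.dualDiff_dualDiff
        C.bounded_dual (fun i j => extVanishes_homology_of_residueField _ hm j (hall i)) j)
    rw [edepth_eq_top fun i => C.extVanishes_of_forall_homExact hl (e := i + 1)
      (fun j _ => hM j) i i.lt_succ_self, EReal.sub_top]
    refine sSup_eq_bot.2 ?_
    rintro _ ⟨i, rfl, hi⟩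
    exact absurd ((hTor i).2 (hall i)) (not_subsingleton_iff_nontrivial.2 hi)
  · obtain ⟨s, hs, hs'⟩ : ∃ s, ¬ ExtVanishes R (IsLocalRing.ResidueField R) (M →ₗ[R] E) s ∧
        ∀ i, s < i → ExtVanishes R (IsLocalRing.ResidueField R) (M →ₗ[R] E) i := by
      push Not at hall
      obtain ⟨i, hi⟩ := hall
      have hin : i ≤ n := le_of_not_ge fun h => hi (hExt i h)
      refine ⟨_, Nat.findGreatest_spec (P := fun i => ¬ ExtVanishes R _ (M →ₗ[R] E) i) hin hi,
        fun j hj => ?_⟩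
      obtain hjn | hjn := le_total n j
      · exact hExt j hjn
      · exact not_not.1 (Nat.findGreatest_is_greatest hj hjn)
    have h0 := C.subsingleton_zero
    obtain ⟨e, hed, he, he'⟩ := exists_first_not_homExact C.dualDiff_dualDiff C.bounded_dual
      (fun j hj => (C.subsingleton_homology_dualDiff_iff j).2 (hd j hj)) hm hs' hs
      (not_subsingleton_iff_nontrivial.1 (by rwa [C.subsingleton_homology_dualDiff_iff]))
      inferInstance
    rw [C.edepth_eq hl (fun j hj => (C.homExact_dualDiff_iff hE j).1 (he' j hj))
      (by rwa [← C.homExact_dualDiff_iff hE e]), ← hed]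
    have hsup : torSup R (ModuleCat.of R (IsLocalRing.ResidueField R)) (ModuleCat.of R M) = s := by
      refine le_antisymm (sSup_le ?_) (le_sSup ⟨s, rfl, ?_⟩)
      · rintro _ ⟨i, rfl, hi⟩
        by_contra hlt
        exact not_subsingleton_iff_nontrivial.2 hi ((hTor i).2 (hs' i (by simpa using hlt)))
      · rwa [← not_subsingleton_iff_nontrivial, hTor]
    rw [hsup, Nat.cast_add, add_comm]
    exact (EReal.add_sub_cancel_right (b := (e : ℝ))).symm
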